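/- Let F : ℝ^m → ℝ^m be monotone and L-Lipschitz, r : ℝ^m → ℝ ∪ {+∞} proper, convex and lower semicontinuous, and let B ⊂ ℝ^m be a compact set with diameter D := sup_{w,z∈B} ‖z−w‖ containing the starting point z₀. Consider the FBFp iteration with w_{−1} = z₀: w_k = prox_{α_k r}(z_k − α_k F(w_{k−1})), z_{k+1} = w_k + α_k (F(w_{k−1}) − F(w_k)) with step sizes satisfying 0 < α_k ≤ α ≤ 1/(2L). Then for every K ≥ 1 the averaged iterate w̄_K := (Σ_{k=0}^{K−1} α_k w_k)/(Σ_{k=0}^{K−1} α_k) satisfies G_B(w̄_K) ≤ D² / (2 Σ_{k=0}^{K−1} α_k), where G_B(w) := sup_{z∈B} ⟨F(z), w−z⟩ + r(w) − r(z). -/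

import Mathlib

open scoped RealInnerProductSpace ENNReal
open MeasureTheory ProbabilityTheory

noncomputable section

/-- A monotone operator on a real inner product space. -/
def MonotoneOp {E : Type*} [NormedAddCommGroup E] [InnerProductSpace ℝ E]
    (F : E → E) : Prop :=
  ∀ z z' : E, 0 ≤ ⟪F z - F z', z - z'⟫

/-- An `L`-Lipschitz operator. -/
def LipschitzOp {E : Type*} [NormedAddCommGroup E] (L : ℝ) (F : E → E) : Prop :=
  ∀ z z' : E, ‖F z - F z'‖ ≤ L * ‖z - z'‖

/-- A proper function with values in `ℝ ∪ {+∞}`: it never takes the value `-∞`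
and is finite somewhere. -/
def ProperFn {E : Type*} (r : E → EReal) : Prop :=
  (∀ w, r w ≠ ⊥) ∧ (∃ w, r w ≠ ⊤)

/-- Convexity of an extended-real-valued function. -/
def ConvexFn {E : Type*} [AddCommMonoid E] [Module ℝ E] (r : E → EReal) : Prop :=
  ∀ x y : E, ∀ a b : ℝ, 0 ≤ a → 0 ≤ b → a + b = 1 →
    r (a • x + b • y) ≤ (a : EReal) * r x + (b : EReal) * r y

/-- `p` is the proximal point `prox_{lam·r}(x)`, i.e. a minimizer of
`w' ↦ r(w') + (1/(2·lam))‖w' - x‖²`. -/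
def IsProxPt {E : Type*} [NormedAddCommGroup E] (r : E → EReal) (lam : ℝ)
    (x p : E) : Prop :=
  ∀ q : E, r p + (((2 * lam)⁻¹ * ‖p - x‖ ^ 2 : ℝ) : EReal)
    ≤ r q + (((2 * lam)⁻¹ * ‖q - x‖ ^ 2 : ℝ) : EReal)

/-- One term `⟨F(z), w - z⟩ + r(w) - r(z)` of the restricted gap function,
with the convention that `∞ - ∞` is interpreted as `+∞`. -/
def gapTerm {E : Type*} [NormedAddCommGroup E] [InnerProductSpace ℝ E]
    (F : E → E) (r : E → EReal) (w z : E) : EReal :=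
  if r w = ⊤ ∧ r z = ⊤ then ⊤
  else ((⟪F z, w - z⟫ : ℝ) : EReal) + r w - r z

/-- The restricted gap function `G_B(w) = sup_{z ∈ B} ⟨F(z), w - z⟩ + r(w) - r(z)`. -/
def gapFn {E : Type*} [NormedAddCommGroup E] [InnerProductSpace ℝ E]
    (F : E → E) (r : E → EReal) (B : Set E) (w : E) : EReal :=
  ⨆ z ∈ B, gapTerm F r w z

/-- The quantity `g(w,z) = ⟨F(w), w - z⟩ + r(w) - r(z)` associated to the strong
variational inequality. -/
def gFn {E : Type*} [NormedAddCommGroup E] [InnerProductSpace ℝ E]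
    (F : E → E) (r : E → EReal) (w z : E) : EReal :=
  ((⟪F w, w - z⟫ : ℝ) : EReal) + r w - r z

/-- `w` solves the monotone inclusion `0 ∈ F(w) + ∂r(w)`, i.e. `-F(w) ∈ ∂r(w)`. -/
def SolvesInclusion {E : Type*} [NormedAddCommGroup E] [InnerProductSpace ℝ E]
    (F : E → E) (r : E → EReal) (w : E) : Prop :=
  ∀ w' : E, ((⟪-F w, w' - w⟫ : ℝ) : EReal) + r w ≤ r w'

/-- The positive part of an extended real number, as an element of `ℝ≥0∞`. -/
def erealPosPart (x : EReal) : ℝ≥0∞ :=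
  if x = ⊤ then ⊤ else ENNReal.ofReal x.toReal

/-- The expectation of an extended-real-valued random variable: the difference of
the (unsigned) integrals of its positive and negative parts. -/
def erealExp {Ω : Type*} [MeasurableSpace Ω] (μ : Measure Ω) (X : Ω → EReal) : EReal :=
  ((∫⁻ ω, erealPosPart (X ω) ∂μ : ℝ≥0∞) : EReal)
    - ((∫⁻ ω, erealPosPart (-(X ω)) ∂μ : ℝ≥0∞) : EReal)

/-- The weighted average `w̄_K = (∑_{k<K} α_k w_k) / (∑_{k<K} α_k)`. -/
def avgIter {E : Type*} [AddCommGroup E] [Module ℝ E] (α : ℕ → ℝ) (w : ℕ → E)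
    (K : ℕ) : E :=
  (∑ k ∈ Finset.range K, α k)⁻¹ • ∑ k ∈ Finset.range K, α k • w k

end

theorem ConvexFn.convexOn_toReal {E : Type*} [AddCommGroup E] [Module ℝ E] {r : E → EReal}
    (hconv : ConvexFn r) (hbot : ∀ x, r x ≠ ⊥) :
    ConvexOn ℝ {x | r x ≠ ⊤} (fun x => (r x).toReal) := by
  have key : ∀ x, r x ≠ ⊤ → ∀ y, r y ≠ ⊤ → ∀ a b : ℝ, 0 ≤ a → 0 ≤ b → a + b = 1 →
      r (a • x + b • y) ≤ ((a * (r x).toReal + b * (r y).toReal : ℝ) : EReal) := by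
    intro x hx y hy a b ha hb hab
    have h := hconv x y a b ha hb hab
    rw [← EReal.coe_toReal hx (hbot x), ← EReal.coe_toReal hy (hbot y)] at h
    exact_mod_cast h
  have hdom : ∀ x, r x ≠ ⊤ → ∀ y, r y ≠ ⊤ → ∀ a b : ℝ, 0 ≤ a → 0 ≤ b → a + b = 1 →
      r (a • x + b • y) ≠ ⊤ := fun x hx y hy a b ha hb hab =>
    ((key x hx y hy a b ha hb hab).trans_lt (EReal.coe_lt_top _)).ne
  refine ⟨fun x hx y hy a b ha hb hab => hdom x hx y hy a b ha hb hab,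
    fun x hx y hy a b ha hb hab => ?_⟩
  have h := key x hx y hy a b ha hb hab
  rw [← EReal.coe_toReal (hdom x hx y hy a b ha hb hab) (hbot _)] at h
  exact_mod_cast h

theorem IsProxPt.ne_top {E : Type*} [NormedAddCommGroup E] {r : E → EReal} {lam : ℝ} {x p : E}
    (hp : IsProxPt r lam x p) (hr : ProperFn r) : r p ≠ ⊤ := by
  obtain ⟨q, hq⟩ := hr.2
  intro htop
  have h := hp q
  rw [htop, ← EReal.coe_toReal hq (hr.1 q), EReal.top_add_coe, ← EReal.coe_add, top_le_iff] at h
  exact EReal.coe_ne_top _ h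

theorem nonpos_of_forall_le_mul {A C : ℝ} (h : ∀ t : ℝ, 0 < t → t ≤ 1 → A ≤ t * C) :
    A ≤ 0 := by
  have hlim : Filter.Tendsto (fun t : ℝ => t * C) (nhdsWithin 0 (Set.Ioi 0)) (nhds 0) := by
    have : Filter.Tendsto (fun t : ℝ => t * C) (nhds 0) (nhds (0 * C)) :=
      (continuous_id.mul continuous_const).tendsto 0
    rw [zero_mul] at this
    exact this.mono_left nhdsWithin_le_nhds
  refine ge_of_tendsto hlim ?_
  filter_upwards [Ioc_mem_nhdsGT (zero_lt_one (α := ℝ))] with t ht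
  exact h t ht.1 ht.2

/-- The variational inequality characterizing the proximal point. -/
theorem IsProxPt.mul_sub_le_inner {E : Type*} [NormedAddCommGroup E] [InnerProductSpace ℝ E]
    {r : E → EReal} {lam : ℝ} {x p q : E} (hp : IsProxPt r lam x p) (hlam : 0 < lam)
    (hr : ProperFn r) (hconv : ConvexFn r) (hq : r q ≠ ⊤) :
    lam * ((r p).toReal - (r q).toReal) ≤ ⟪p - x, q - p⟫ := by
  have hptop := hp.ne_top hr
  have hcv := hconv.convexOn_toReal hr.1
  refine sub_nonpos.1 (nonpos_of_forall_le_mul (C := ‖q - p‖ ^ 2 / 2) fun t ht0 ht1 => ?_)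
  have hjensen := hcv.2 hptop hq (sub_nonneg.2 ht1) ht0.le (sub_add_cancel 1 t)
  have hmem := hcv.1 hptop hq (sub_nonneg.2 ht1) ht0.le (sub_add_cancel 1 t)
  have hmin := hp ((1 - t) • p + t • q)
  rw [← EReal.coe_toReal hptop (hr.1 p), ← EReal.coe_toReal hmem (hr.1 _), ← EReal.coe_add,
    ← EReal.coe_add, EReal.coe_le_coe_iff] at hmin
  have hexp : ‖(1 - t) • p + t • q - x‖ ^ 2
      = ‖p - x‖ ^ 2 + 2 * (t * ⟪p - x, q - p⟫) + t ^ 2 * ‖q - p‖ ^ 2 := by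
    rw [show (1 - t) • p + t • q - x = (p - x) + t • (q - p) by module, norm_add_sq_real,
      inner_smul_right, norm_smul, mul_pow, Real.norm_eq_abs, sq_abs]
  simp only [smul_eq_mul] at hjensen
  rw [hexp] at hmin
  have hdiff : t * ((r p).toReal - (r q).toReal)
      ≤ (2 * lam)⁻¹ * (2 * (t * ⟪p - x, q - p⟫) + t ^ 2 * ‖q - p‖ ^ 2) := by
    linarith
  rw [inv_mul_eq_div, le_div_iff₀ (by positivity)] at hdiff
  refine le_of_mul_le_mul_left (a := 2 * t) ?_ (by positivity)
  linarith

/-- One step of the iteration decreases the Lyapunov function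
`‖z_k - q‖² + ‖z_k - w_{k-1}‖²`. -/
theorem two_mul_gap_le_lyapunov_sub {E : Type*} [NormedAddCommGroup E] [InnerProductSpace ℝ E]
    {F : E → E} {L : ℝ} (hL : 0 < L) (hmono : MonotoneOp F) (hlip : LipschitzOp L F)
    {r : E → EReal} (hr : ProperFn r) (hconv : ConvexFn r) {lam : ℝ} (hlam : 0 < lam)
    (hlamL : lam ≤ 1 / (2 * L)) {z z' w w' q : E} (hw : IsProxPt r lam (z - lam • F w) w')
    (hz : z' = w' + lam • (F w - F w')) (hq : r q ≠ ⊤) :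
    2 * (lam * (⟪F q, w' - q⟫ + (r w').toReal - (r q).toReal))
      ≤ (‖z - q‖ ^ 2 + ‖z - w‖ ^ 2) - (‖z' - q‖ ^ 2 + ‖z' - w'‖ ^ 2) := by
  have hprox := hw.mul_sub_le_inner hlam hr hconv hq
  have hinner : ⟪w' - (z - lam • F w), q - w'⟫
      = ⟪z' - z, q - w'⟫ - lam * ⟪F w', w' - q⟫ := by
    rw [show w' - (z - lam • F w) = (z' - z) + lam • F w' by rw [hz]; module, inner_add_left,
      inner_smul_left, ← neg_sub w' q, inner_neg_right, inner_neg_right]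
    simp only [conj_trivial]
    ring
  have hpolar : 2 * ⟪z' - z, q - w'⟫
      = ‖z - q‖ ^ 2 - ‖z' - q‖ ^ 2 + ‖z' - w'‖ ^ 2 - ‖z - w'‖ ^ 2 := by
    simp only [norm_sub_sq_real, inner_sub_left, inner_sub_right]
    ring
  have hmono' : lam * ⟪F q, w' - q⟫ ≤ lam * ⟪F w', w' - q⟫ := by
    have h := hmono w' q
    rw [inner_sub_left] at h
    exact mul_le_mul_of_nonneg_left (by linarith) hlam.le
  have hstep : ‖z' - w'‖ ≤ (‖z - w'‖ + ‖z - w‖) / 2 := by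
    have hlamL' : lam * L ≤ 1 / 2 := by
      rw [le_div_iff₀ (by positivity)] at hlamL
      linarith
    have htri : ‖w - w'‖ ≤ ‖z - w'‖ + ‖z - w‖ := by
      have h := norm_sub_le (z - w') (z - w)
      rwa [sub_sub_sub_cancel_left] at h
    calc ‖z' - w'‖ = lam * ‖F w - F w'‖ := by
          rw [hz, add_sub_cancel_left, norm_smul, Real.norm_of_nonneg hlam.le]
      _ ≤ lam * (L * ‖w - w'‖) := mul_le_mul_of_nonneg_left (hlip w w') hlam.le
      _ = lam * L * ‖w - w'‖ := by ring
      _ ≤ 1 / 2 * ‖w - w'‖ := mul_le_mul_of_nonneg_right hlamL' (norm_nonneg _)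
      _ ≤ _ := by linarith
  have hsq := pow_le_pow_left₀ (norm_nonneg _) hstep 2
  have hlast : 2 * ‖z' - w'‖ ^ 2 ≤ ‖z - w'‖ ^ 2 + ‖z - w‖ ^ 2 := by
    nlinarith [sq_nonneg (‖z - w'‖ - ‖z - w‖)]
  linarith

theorem gapTerm_le_coe {E : Type*} [NormedAddCommGroup E] [InnerProductSpace ℝ E]
    {F : E → E} {r : E → EReal} (hr : ProperFn r) {w q : E} (hw : r w ≠ ⊤) {c : ℝ}
    (h : r q ≠ ⊤ → ⟪F q, w - q⟫ + (r w).toReal - (r q).toReal ≤ c) :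
    gapTerm F r w q ≤ c := by
  rw [gapTerm, if_neg fun h => hw h.1, ← EReal.coe_toReal hw (hr.1 w)]
  by_cases hq : r q = ⊤
  · simp [hq]
  · rw [← EReal.coe_toReal hq (hr.1 q)]
    exact_mod_cast h hq

/-- Deterministic FBFp convergence, Theorem 1(ii)/Theorem 4(ii).
For a monotone `L`-Lipschitz operator `F` and a proper convex lsc regularizer `r`,
the FBFp iteration `w_k = prox_{α_k r}(z_k - α_k F(w_{k-1}))`,
`z_{k+1} = w_k + α_k (F(w_{k-1}) - F(w_k))`, with `w_{-1} = z_0` and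
`0 < α_k ≤ α ≤ 1/(2L)`, satisfies `G_B(w̄_K) ≤ D² / (2 ∑_{k<K} α_k)`.
Here `wm k` denotes `w_{k-1}`. -/
theorem fbfp_deterministic {m : ℕ}
    (F : EuclideanSpace ℝ (Fin m) → EuclideanSpace ℝ (Fin m)) (L : ℝ) (hL : 0 < L)
    (hmono : MonotoneOp F) (hlip : LipschitzOp L F)
    (r : EuclideanSpace ℝ (Fin m) → EReal)
    (hproper : ProperFn r) (hconv : ConvexFn r) (hlsc : LowerSemicontinuous r)
    (B : Set (EuclideanSpace ℝ (Fin m))) (hB : IsCompact B)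
    (α : ℕ → ℝ) (a : ℝ)
    (hαpos : ∀ k, 0 < α k) (hαa : ∀ k, α k ≤ a) (haL : a ≤ 1 / (2 * L))
    (z w wm : ℕ → EuclideanSpace ℝ (Fin m)) (hz0 : z 0 ∈ B)
    (hwm0 : wm 0 = z 0) (hwm : ∀ k, wm (k + 1) = w k)
    (hw : ∀ k, IsProxPt r (α k) (z k - α k • F (wm k)) (w k))
    (hz : ∀ k, z (k + 1) = w k + α k • (F (wm k) - F (w k)))
    (K : ℕ) (hK : 1 ≤ K) :
    gapFn F r B (avgIter α w K)
      ≤ ((Metric.diam B ^ 2 / (2 * ∑ k ∈ Finset.range K, α k) : ℝ) : EReal) := by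
  have hS : 0 < ∑ k ∈ Finset.range K, α k :=
    Finset.sum_pos (fun k _ => hαpos k) (Finset.nonempty_range_iff.2 (by omega))
  have hwtop : ∀ k, r (w k) ≠ ⊤ := fun k => (hw k).ne_top hproper
  have hcv := hconv.convexOn_toReal hproper.1
  have havg : avgIter α w K = (Finset.range K).centerMass α w := rfl
  have havgtop : r (avgIter α w K) ≠ ⊤ :=
    hcv.1.centerMass_mem (fun k _ => (hαpos k).le) hS (fun k _ => hwtop k)
  have hjensen := hcv.map_centerMass_le (t := Finset.range K) (w := α) (p := w)
    (fun k _ => (hαpos k).le) hS (fun k _ => hwtop k)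
  rw [← havg, Finset.centerMass, smul_eq_mul, inv_mul_eq_div, le_div_iff₀ hS] at hjensen
  refine iSup₂_le fun q hqB => gapTerm_le_coe hproper havgtop fun hq => ?_
  rw [le_div_iff₀ (by positivity)]
  have hsum := Finset.sum_le_sum fun k (_ : k ∈ Finset.range K) =>
    two_mul_gap_le_lyapunov_sub hL hmono hlip hproper hconv (hαpos k) ((hαa k).trans haL)
      (hw k) (hz k) hq
  simp only [← hwm] at hsum
  rw [Finset.sum_range_sub' (fun k => ‖z k - q‖ ^ 2 + ‖z k - wm k‖ ^ 2), hwm0, sub_self,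
    norm_zero] at hsum
  simp only [hwm] at hsum
  have hdiam : ‖z 0 - q‖ ^ 2 ≤ Metric.diam B ^ 2 := by
    rw [← dist_eq_norm]
    exact pow_le_pow_left₀ dist_nonneg (Metric.dist_le_diam_of_mem hB.isBounded hz0 hqB) 2
  have hlin : (∑ k ∈ Finset.range K, α k) * ⟪F q, avgIter α w K - q⟫
      = ∑ k ∈ Finset.range K, α k * ⟪F q, w k - q⟫ := by
    rw [avgIter, inner_sub_right, inner_smul_right, inner_sum, mul_sub,
      mul_inv_cancel_left₀ hS.ne']
    simp only [inner_smul_right, inner_sub_right, mul_sub, Finset.sum_sub_distrib, Finset.sum_mul]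
  have hsplit : ∑ k ∈ Finset.range K,
      2 * (α k * (⟪F q, w k - q⟫ + (r (w k)).toReal - (r q).toReal))
      = 2 * (∑ k ∈ Finset.range K, α k * ⟪F q, w k - q⟫
        + ∑ k ∈ Finset.range K, α k * (r (w k)).toReal
        - (∑ k ∈ Finset.range K, α k) * (r q).toReal) := by
    rw [← Finset.mul_sum, Finset.sum_mul, ← Finset.sum_add_distrib, ← Finset.sum_sub_distrib]
    congr 1
    exact Finset.sum_congr rfl fun k _ => by ring
  rw [hsplit, ← hlin] at hsum
  simp only [Function.comp_apply, smul_eq_mul] at hjensen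
  nlinarith [sq_nonneg ‖z K - q‖, sq_nonneg ‖z K - wm K‖]
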